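/- arXiv:1908.11082 — 4 statements merged into one kernel-verified Lean document; each statement's English description precedes it below -/
import Mathlib

section
/- Let 1 < q₂ ≤ q₁ < ∞ be reals, set q̃ = q₂(q₁-1)/(q₁(q₂-1)), and let s be a real with 1 ≤ s ≤ p^{1/q̃}. Then for any linear measurement map A, β_{q₂,s^{q̃}}(A) ≥ s^{-q̃}·β_{q₁,s^{q̃}}(A). -/
open scoped BigOperators

noncomputable section

/-- Mixed ℓ₂/ℓ₁ norm of a block signal: sum of the Euclidean norms of the blocks. -/
def mnorm1 {p n : ℕ} (x : Fin p → EuclideanSpace ℝ (Fin n)) : ℝ := ∑ i, ‖x i‖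

/-- Mixed ℓ₂/ℓ_q norm of a block signal. -/
def mnorm {p n : ℕ} (q : ℝ) (x : Fin p → EuclideanSpace ℝ (Fin n)) : ℝ :=
  (∑ i, ‖x i‖ ^ q) ^ (1 / q)

/-- The q-ratio block sparsity k_q(x) = (‖x‖_{2,1}/‖x‖_{2,q})^{q/(q-1)}. -/
def blockSparsity {p n : ℕ} (q : ℝ) (x : Fin p → EuclideanSpace ℝ (Fin n)) : ℝ :=
  (mnorm1 x / mnorm q x) ^ (q / (q - 1))

/-- The q-ratio block constrained minimal singular value of a measurement map. -/
def bcmsv {p n m : ℕ} (q s : ℝ)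
    (A : (Fin p → EuclideanSpace ℝ (Fin n)) →ₗ[ℝ] EuclideanSpace ℝ (Fin m)) : ℝ :=
  sInf {r : ℝ | ∃ z : Fin p → EuclideanSpace ℝ (Fin n),
    z ≠ 0 ∧ blockSparsity q z ≤ s ∧ r = ‖A z‖ / mnorm q z}

/-- Dividing the block norms by their sum turns a nonzero block signal into a probability vector. -/
def blockWeight {p n : ℕ} (x : Fin p → EuclideanSpace ℝ (Fin n)) (i : Fin p) : ℝ :=
  ‖x i‖ / mnorm1 x

section

variable {p n : ℕ} {x : Fin p → EuclideanSpace ℝ (Fin n)}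

theorem mnorm1_pos (hx : x ≠ 0) : 0 < mnorm1 x := by
  obtain ⟨i, hi⟩ := Function.ne_iff.1 hx
  exact Finset.sum_pos' (fun j _ => norm_nonneg (x j)) ⟨i, Finset.mem_univ i, norm_pos_iff.2 hi⟩

theorem blockWeight_nonneg (hx : x ≠ 0) (i : Fin p) : 0 ≤ blockWeight x i :=
  div_nonneg (norm_nonneg _) (mnorm1_pos hx).le

theorem sum_blockWeight (hx : x ≠ 0) : ∑ i, blockWeight x i = 1 := by
  unfold blockWeight
  rw [← Finset.sum_div]
  exact div_self (mnorm1_pos hx).ne'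

theorem sum_blockWeight_rpow_pos (hx : x ≠ 0) (q : ℝ) : 0 < ∑ i, blockWeight x i ^ q := by
  obtain ⟨i, hi⟩ := Function.ne_iff.1 hx
  exact Finset.sum_pos' (fun j _ => Real.rpow_nonneg (blockWeight_nonneg hx j) q)
    ⟨i, Finset.mem_univ i, Real.rpow_pos_of_pos (div_pos (norm_pos_iff.2 hi) (mnorm1_pos hx)) q⟩

theorem sum_blockWeight_rpow_le_one (hx : x ≠ 0) {q : ℝ} (hq : 1 ≤ q) :
    ∑ i, blockWeight x i ^ q ≤ 1 := by
  rw [← sum_blockWeight hx]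
  refine Finset.sum_le_sum fun i _ => ?_
  refine Real.rpow_le_self_of_le_one (blockWeight_nonneg hx i) ?_ hq
  rw [← sum_blockWeight hx]
  exact Finset.single_le_sum (fun j _ => blockWeight_nonneg hx j) (Finset.mem_univ i)

theorem mnorm_eq_mnorm1_mul (hx : x ≠ 0) {q : ℝ} (hq : q ≠ 0) :
    mnorm q x = mnorm1 x * (∑ i, blockWeight x i ^ q) ^ (1 / q) := by
  have hN := mnorm1_pos hx
  have h : ∑ i, ‖x i‖ ^ q = mnorm1 x ^ q * ∑ i, blockWeight x i ^ q := by
    rw [Finset.mul_sum]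
    refine Finset.sum_congr rfl fun i _ => ?_
    rw [← Real.mul_rpow hN.le (blockWeight_nonneg hx i), blockWeight, mul_div_cancel₀ _ hN.ne']
  rw [mnorm, h, Real.mul_rpow (Real.rpow_nonneg hN.le q) (sum_blockWeight_rpow_pos hx q).le,
    ← Real.rpow_mul hN.le, mul_one_div_cancel hq, Real.rpow_one]

theorem mnorm_pos (hx : x ≠ 0) {q : ℝ} (hq : q ≠ 0) : 0 < mnorm q x := by
  rw [mnorm_eq_mnorm1_mul hx hq]
  exact mul_pos (mnorm1_pos hx) (Real.rpow_pos_of_pos (sum_blockWeight_rpow_pos hx q) _)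

theorem mnorm_le_mnorm1 (hx : x ≠ 0) {q : ℝ} (hq : 1 ≤ q) : mnorm q x ≤ mnorm1 x := by
  rw [mnorm_eq_mnorm1_mul hx (by positivity)]
  exact mul_le_of_le_one_right (mnorm1_pos hx).le
    (Real.rpow_le_one (sum_blockWeight_rpow_pos hx q).le (sum_blockWeight_rpow_le_one hx hq)
      (by positivity))

/-- The block sparsity is the exponential of the Rényi entropy of the block weights. -/
theorem blockSparsity_eq (hx : x ≠ 0) {q : ℝ} (hq : q ≠ 0) :
    blockSparsity q x = (∑ i, blockWeight x i ^ q) ^ (-(1 / (q - 1))) := by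
  have hP := sum_blockWeight_rpow_pos hx q
  rw [blockSparsity, mnorm_eq_mnorm1_mul hx hq, div_mul_cancel_left₀ (mnorm1_pos hx).ne',
    ← Real.rpow_neg hP.le, ← Real.rpow_mul hP.le]
  congr 1
  field_simp

/-- The block sparsity is nonincreasing in its order. -/
theorem blockSparsity_anti (hx : x ≠ 0) {q r : ℝ} (hq : 1 < q) (hqr : q ≤ r) :
    blockSparsity r x ≤ blockSparsity q x := by
  have hq0 : 0 < q - 1 := sub_pos.2 hq
  have hr0 : 0 < r - 1 := by linarith
  have hP := sum_blockWeight_rpow_pos hx q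
  have key : (∑ i, blockWeight x i ^ q) ^ ((r - 1) / (q - 1)) ≤ ∑ i, blockWeight x i ^ r := by
    have h := Real.rpow_arith_mean_le_arith_mean_rpow Finset.univ (blockWeight x)
      (fun i => blockWeight x i ^ (q - 1)) (fun i _ => blockWeight_nonneg hx i)
      (sum_blockWeight hx) (fun i _ => Real.rpow_nonneg (blockWeight_nonneg hx i) _)
      (p := (r - 1) / (q - 1)) ((one_le_div hq0).2 (by linarith))
    have hmul (t : ℝ) (ht : 0 < t - 1) (i : Fin p) :
        blockWeight x i * blockWeight x i ^ (t - 1) = blockWeight x i ^ t := by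
      rw [← Real.rpow_one_add' (blockWeight_nonneg hx i) (by linarith), add_sub_cancel]
    simpa only [← Real.rpow_mul (blockWeight_nonneg hx _), mul_div_cancel₀ _ hq0.ne',
      hmul q hq0, hmul r hr0] using h
  rw [blockSparsity_eq hx (by linarith), blockSparsity_eq hx (by linarith)]
  calc (∑ i, blockWeight x i ^ r) ^ (-(1 / (r - 1)))
      ≤ ((∑ i, blockWeight x i ^ q) ^ ((r - 1) / (q - 1))) ^ (-(1 / (r - 1))) :=
        Real.rpow_le_rpow_of_nonpos (Real.rpow_pos_of_pos hP _) key
          (neg_nonpos.2 (one_div_pos.2 hr0).le)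
    _ = (∑ i, blockWeight x i ^ q) ^ (-(1 / (q - 1))) := by
        rw [← Real.rpow_mul hP.le]
        congr 1
        field_simp

theorem mnorm1_le_blockSparsity_mul_mnorm (hx : x ≠ 0) {q : ℝ} (hq : 1 < q) :
    mnorm1 x ≤ blockSparsity q x * mnorm q x := by
  have hM := mnorm_pos hx (q := q) (by linarith)
  rw [← div_le_iff₀ hM, blockSparsity]
  refine Real.self_le_rpow_of_one_le ((one_le_div hM).2 (mnorm_le_mnorm1 hx hq.le)) ?_
  rw [one_le_div (by linarith)]
  linarith

theorem blockSparsity_single {i : Fin p} {v : EuclideanSpace ℝ (Fin n)} (hv : v ≠ 0)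
    {q : ℝ} (hq : q ≠ 0) : blockSparsity q (Pi.single i v) = 1 := by
  have h1 : mnorm1 (Pi.single i v) = ‖v‖ := by
    rw [mnorm1, Finset.sum_eq_single i (by simp +contextual) (by simp)]
    simp
  have h2 : mnorm q (Pi.single i v) = ‖v‖ := by
    rw [mnorm, Finset.sum_eq_single i
      (by simp +contextual [Real.zero_rpow hq]) (by simp),
      Pi.single_eq_same, ← Real.rpow_mul (norm_nonneg v), mul_one_div_cancel hq, Real.rpow_one]
  rw [blockSparsity, h1, h2, div_self (norm_ne_zero_iff.2 hv), Real.one_rpow]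

/-- Comparison of the constrained minimal singular values of two orders at a common sparsity level. -/
theorem inv_mul_bcmsv_le_bcmsv {m : ℕ}
    (A : (Fin p → EuclideanSpace ℝ (Fin n)) →ₗ[ℝ] EuclideanSpace ℝ (Fin m))
    {q r S : ℝ} (hq : 1 < q) (hqr : q ≤ r) (hS : 1 ≤ S) :
    S⁻¹ * bcmsv r S A ≤ bcmsv q S A := by
  have hr : 1 < r := hq.trans_le hqr
  have hS0 : 0 < S := by linarith
  rcases subsingleton_or_nontrivial (Fin p → EuclideanSpace ℝ (Fin n)) with hsub | hnon
  · have hz (z : Fin p → EuclideanSpace ℝ (Fin n)) : z = 0 := Subsingleton.elim _ _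
    simp [bcmsv, hz]
  obtain ⟨x, hx⟩ := exists_ne (0 : Fin p → EuclideanSpace ℝ (Fin n))
  obtain ⟨i, hi⟩ := Function.ne_iff.1 hx
  refine le_csInf ⟨_, Pi.single i (x i), by simpa using hi,
    (blockSparsity_single hi (by linarith)).trans_le hS, rfl⟩ ?_
  rintro _ ⟨z, hz, hzS, rfl⟩
  have hzr : blockSparsity r z ≤ S := (blockSparsity_anti hz hq hqr).trans hzS
  have hMr := mnorm_pos hz (q := r) (by linarith)
  have hMq := mnorm_pos hz (q := q) (by linarith)
  have hbdd : BddBelow {t : ℝ | ∃ z : Fin p → EuclideanSpace ℝ (Fin n),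
      z ≠ 0 ∧ blockSparsity r z ≤ S ∧ t = ‖A z‖ / mnorm r z} := by
    refine ⟨0, ?_⟩
    rintro _ ⟨y, hy, -, rfl⟩
    exact div_nonneg (norm_nonneg _) (mnorm_pos hy (by linarith)).le
  have hnorm : mnorm q z ≤ S * mnorm r z :=
    (mnorm_le_mnorm1 hz hq.le).trans <| (mnorm1_le_blockSparsity_mul_mnorm hz hr).trans <|
      mul_le_mul_of_nonneg_right hzr hMr.le
  calc S⁻¹ * bcmsv r S A ≤ S⁻¹ * (‖A z‖ / mnorm r z) :=
        mul_le_mul_of_nonneg_left (csInf_le hbdd ⟨z, hz, hzr, rfl⟩) (inv_pos.2 hS0).le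
    _ = ‖A z‖ / (S * mnorm r z) := by field_simp
    _ ≤ ‖A z‖ / mnorm q z := div_le_div_of_nonneg_left (norm_nonneg _) hMq hnorm

end

/-- For 1 < q₂ ≤ q₁ and q̃ = q₂(q₁-1)/(q₁(q₂-1)), 1 ≤ s ≤ p^{1/q̃}:
β_{q₂,s^q̃}(A) ≥ s^{-q̃}·β_{q₁,s^q̃}(A). -/
theorem stmt_2 {p n m : ℕ}
    (A : (Fin p → EuclideanSpace ℝ (Fin n)) →ₗ[ℝ] EuclideanSpace ℝ (Fin m))
    (q₁ q₂ : ℝ) (hq₂ : 1 < q₂) (hq : q₂ ≤ q₁)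
    (s : ℝ) (hs1 : 1 ≤ s)
    (hs2 : s ≤ (p : ℝ) ^ (1 / (q₂ * (q₁ - 1) / (q₁ * (q₂ - 1))))) :
    s ^ (-(q₂ * (q₁ - 1) / (q₁ * (q₂ - 1)))) *
      bcmsv q₁ (s ^ (q₂ * (q₁ - 1) / (q₁ * (q₂ - 1)))) A ≤
      bcmsv q₂ (s ^ (q₂ * (q₁ - 1) / (q₁ * (q₂ - 1)))) A := by
  rw [Real.rpow_neg (by linarith)]
  refine inv_mul_bcmsv_le_bcmsv A hq₂ hq (Real.one_le_rpow hs1 ?_)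
  exact div_nonneg (mul_nonneg (by linarith) (by linarith))
    (mul_nonneg (by linarith) (by linarith))
end
end

section
/- Mixed ℓ₂/ℓ₁ error bound for the block Basis Pursuit (BBP) with block k-sparse signals: let q > 1 be real, k ≥ 1, x block k-sparse, ζ ≥ 0, ε with ‖ε‖₂ ≤ ζ, and y = A x + ε. Let x̂ satisfy ‖y − A x̂‖₂ ≤ ζ and ‖x̂‖_{2,1} ≤ ‖z‖_{2,1} for every z with ‖y − A z‖₂ ≤ ζ. Suppose β > 0 is such that ‖A z‖₂ ≥ β·‖z‖_{2,q} for every z with ‖z‖_{2,1} ≤ 2·k^{1-1/q}·‖z‖_{2,q}. Then ‖x̂ − x‖_{2,1} ≤ 4·k^{1-1/q}·ζ/β. -/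
open scoped BigOperators

noncomputable section

/-- Hölder's inequality on a block support of size at most `k`. -/
theorem sum_norm_le_rpow_mul_mnorm {p n k : ℕ} {q : ℝ} (hq : 1 < q) {S : Finset (Fin p)}
    (hS : S.card ≤ k) (x : Fin p → EuclideanSpace ℝ (Fin n)) :
    ∑ i ∈ S, ‖x i‖ ≤ (k : ℝ) ^ (1 - 1 / q) * mnorm q x := by
  have hconj := (Real.HolderConjugate.conjExponent hq).symm
  have hholder := Real.inner_le_Lp_mul_Lq_of_nonneg S hconj
    (f := fun _ => 1) (g := fun i => ‖x i‖) (fun _ _ => zero_le_one) (fun i _ => norm_nonneg (x i))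
  have hexp : 1 / q.conjExponent = 1 - 1 / q := by
    simpa [one_div] using hconj.symm.one_sub_inv.symm
  have hexp_nonneg : 0 ≤ 1 - 1 / q := hexp ▸ one_div_nonneg.2 hconj.nonneg
  simp only [one_mul, Real.one_rpow, Finset.sum_const, nsmul_eq_mul, mul_one, hexp] at hholder
  refine hholder.trans (mul_le_mul ?_ ?_ (by positivity) (by positivity))
  · exact Real.rpow_le_rpow (by positivity) (by exact_mod_cast hS) hexp_nonneg
  · refine Real.rpow_le_rpow (by positivity) ?_ (by positivity)
    exact Finset.sum_le_sum_of_subset_of_nonneg S.subset_univ fun _ _ _ => by positivity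

/-- If `x` is supported on the blocks in `S` and `z` has no larger mixed ℓ₂/ℓ₁ norm, then at least
half of the norm of `z - x` is carried by the blocks in `S`. -/
theorem mnorm1_sub_le_two_mul_sum {p n : ℕ} {S : Finset (Fin p)}
    {x z : Fin p → EuclideanSpace ℝ (Fin n)} (hx : ∀ i ∉ S, x i = 0)
    (hz : mnorm1 z ≤ mnorm1 x) :
    mnorm1 (z - x) ≤ 2 * ∑ i ∈ S, ‖(z - x) i‖ := by
  unfold mnorm1 at *
  have hx_compl : ∑ i ∈ Sᶜ, ‖x i‖ = 0 :=
    Finset.sum_eq_zero fun i hi => by simp [hx i (Finset.mem_compl.1 hi)]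
  have hz_compl : ∑ i ∈ Sᶜ, ‖(z - x) i‖ = ∑ i ∈ Sᶜ, ‖z i‖ :=
    Finset.sum_congr rfl fun i hi => by simp [hx i (Finset.mem_compl.1 hi)]
  have htri : ∑ i ∈ S, ‖x i‖ ≤ ∑ i ∈ S, ‖z i‖ + ∑ i ∈ S, ‖(z - x) i‖ := by
    rw [← Finset.sum_add_distrib]
    exact Finset.sum_le_sum fun i _ => norm_le_norm_add_norm_sub (z i) (x i)
  rw [← Finset.sum_add_sum_compl S] at hz ⊢
  rw [← Finset.sum_add_sum_compl S fun i => ‖x i‖] at hz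
  linarith

/-- Mixed ℓ₂/ℓ₁ error bound for the block Basis Pursuit with block k-sparse signals. -/
theorem stmt_6 {p n m : ℕ}
    (A : (Fin p → EuclideanSpace ℝ (Fin n)) →ₗ[ℝ] EuclideanSpace ℝ (Fin m))
    (q : ℝ) (hq : 1 < q) (k : ℕ) (hk : 1 ≤ k)
    (x : Fin p → EuclideanSpace ℝ (Fin n))
    (hx : ∃ S : Finset (Fin p), S.card ≤ k ∧ ∀ i ∉ S, x i = 0)
    (ζ : ℝ) (hζ : 0 ≤ ζ)
    (ε : EuclideanSpace ℝ (Fin m)) (hε : ‖ε‖ ≤ ζ)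
    (y : EuclideanSpace ℝ (Fin m)) (hy : y = A x + ε)
    (xh : Fin p → EuclideanSpace ℝ (Fin n))
    (hfeas : ‖y - A xh‖ ≤ ζ)
    (hmin : ∀ z : Fin p → EuclideanSpace ℝ (Fin n), ‖y - A z‖ ≤ ζ → mnorm1 xh ≤ mnorm1 z)
    (β : ℝ) (hβ : 0 < β)
    (hcmsv : ∀ z : Fin p → EuclideanSpace ℝ (Fin n),
      mnorm1 z ≤ 2 * (k : ℝ) ^ (1 - 1 / q) * mnorm q z → β * mnorm q z ≤ ‖A z‖) :
    mnorm1 (xh - x) ≤ 4 * (k : ℝ) ^ (1 - 1 / q) * ζ / β := by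
  obtain ⟨S, hS, hxS⟩ := hx
  have hmin_x : mnorm1 xh ≤ mnorm1 x := hmin x (by simpa [hy] using hε)
  have hcone : mnorm1 (xh - x) ≤ 2 * (k : ℝ) ^ (1 - 1 / q) * mnorm q (xh - x) := by
    linarith [mnorm1_sub_le_two_mul_sum hxS hmin_x, sum_norm_le_rpow_mul_mnorm hq hS (xh - x)]
  have hA : ‖A (xh - x)‖ ≤ 2 * ζ := by
    have hsplit : A (xh - x) = ε - (y - A xh) := by
      rw [map_sub, hy]
      abel
    rw [hsplit]
    linarith [norm_sub_le ε (y - A xh)]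
  have hbound : mnorm q (xh - x) ≤ 2 * ζ / β := by
    rw [le_div_iff₀' hβ]
    exact (hcmsv _ hcone).trans hA
  calc mnorm1 (xh - x) ≤ 2 * (k : ℝ) ^ (1 - 1 / q) * mnorm q (xh - x) := hcone
    _ ≤ 2 * (k : ℝ) ^ (1 - 1 / q) * (2 * ζ / β) := by gcongr
    _ = 4 * (k : ℝ) ^ (1 - 1 / q) * ζ / β := by ring
end
end

section
/- Mixed ℓ₂/ℓ_q error bound for the block Basis Pursuit (BBP) with block compressible signals: let q > 1 be real, k ≥ 1, and let x be any block signal. Let S be a set of k block indices containing k largest blocks of x (i.e. ‖x_i‖₂ ≥ ‖x_j‖₂ whenever i ∈ S and j ∉ S), and set φ = ∑_{i∉S} ‖x_i‖₂ (the best block k-term approximation error φ_k(x)). Let ζ ≥ 0, ε with ‖ε‖₂ ≤ ζ, y = A x + ε, and let x̂ satisfy ‖y − A x̂‖₂ ≤ ζ and ‖x̂‖_{2,1} ≤ ‖z‖_{2,1} for every z with ‖y − A z‖₂ ≤ ζ. Suppose β > 0 is such that ‖A z‖₂ ≥ β·‖z‖_{2,q} for every z with ‖z‖_{2,1} ≤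 4·k^{1-1/q}·‖z‖_{2,q} (i.e. β is a lower bound for β_{q,4^{q/(q-1)}k}(A)). Then ‖x̂ − x‖_{2,q} ≤ 2ζ/β + k^{1/q-1}·φ. -/
open scoped BigOperators

noncomputable section

open Finset in
/-- Hölder's inequality comparing the `ℓ₁` norm on a block support with the mixed `ℓ₂/ℓ_q` norm. -/
theorem sum_norm_le_card_rpow_mul_mnorm {p n : ℕ} {q : ℝ} (hq : 1 < q) (S : Finset (Fin p))
    (h : Fin p → EuclideanSpace ℝ (Fin n)) :
    ∑ i ∈ S, ‖h i‖ ≤ (S.card : ℝ) ^ (1 - 1 / q) * mnorm q h := by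
  have hq0 : 0 < q := by linarith
  have hsum : 0 ≤ ∑ i, ‖h i‖ ^ q := sum_nonneg fun i _ => by positivity
  have hpow : (∑ i ∈ S, ‖h i‖) ^ q ≤ (S.card : ℝ) ^ (q - 1) * ∑ i, ‖h i‖ ^ q := by
    have hS := Real.rpow_sum_le_const_mul_sum_rpow S (fun i => ‖h i‖) hq.le
    simp only [abs_norm] at hS
    refine hS.trans (mul_le_mul_of_nonneg_left ?_ (by positivity))
    exact sum_le_univ_sum_of_nonneg fun i => by positivity
  have hroot := Real.rpow_le_rpow (by positivity) hpow (by positivity : (0 : ℝ) ≤ 1 / q)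
  rw [← Real.rpow_mul (by positivity), mul_one_div_cancel hq0.ne', Real.rpow_one,
    Real.mul_rpow (by positivity) hsum, ← Real.rpow_mul (by positivity)] at hroot
  have hexp : (q - 1) * (1 / q) = 1 - 1 / q := by field_simp
  rwa [hexp] at hroot

open Finset in
/-- Cone condition: the error of a competitor with no larger mixed `ℓ₂/ℓ₁` norm is controlled by
its restriction to any support together with the tail of the signal. -/
theorem mnorm1_sub_le_of_mnorm1_le {p n : ℕ} {x z : Fin p → EuclideanSpace ℝ (Fin n)}
    (hzx : mnorm1 z ≤ mnorm1 x) (S : Finset (Fin p)) :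
    mnorm1 (z - x) ≤ 2 * ∑ i ∈ S, ‖(z - x) i‖ + 2 * ∑ i ∈ Sᶜ, ‖x i‖ := by
  simp only [mnorm1] at hzx ⊢
  rw [← sum_add_sum_compl S, ← sum_add_sum_compl S (fun i => ‖x i‖)] at hzx
  rw [← sum_add_sum_compl S]
  have hin : ∑ i ∈ S, ‖x i‖ ≤ ∑ i ∈ S, ‖z i‖ + ∑ i ∈ S, ‖(z - x) i‖ := by
    rw [← sum_add_distrib]
    exact sum_le_sum fun i _ => norm_le_norm_add_norm_sub (z i) (x i)
  have hout : ∑ i ∈ Sᶜ, ‖(z - x) i‖ ≤ ∑ i ∈ Sᶜ, ‖z i‖ + ∑ i ∈ Sᶜ, ‖x i‖ := by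
    rw [← sum_add_distrib]
    exact sum_le_sum fun i _ => norm_sub_le (z i) (x i)
  linarith

/-- Mixed ℓ₂/ℓ_q error bound for the block Basis Pursuit with block compressible signals. -/
theorem stmt_11 {p n m : ℕ}
    (A : (Fin p → EuclideanSpace ℝ (Fin n)) →ₗ[ℝ] EuclideanSpace ℝ (Fin m))
    (q : ℝ) (hq : 1 < q) (k : ℕ) (hk : 1 ≤ k)
    (x : Fin p → EuclideanSpace ℝ (Fin n))
    (S : Finset (Fin p)) (hScard : S.card = k)
    (hSlargest : ∀ i ∈ S, ∀ j ∉ S, ‖x j‖ ≤ ‖x i‖)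
    (φ : ℝ) (hφ : φ = ∑ i ∈ Sᶜ, ‖x i‖)
    (ζ : ℝ) (hζ : 0 ≤ ζ)
    (ε : EuclideanSpace ℝ (Fin m)) (hε : ‖ε‖ ≤ ζ)
    (y : EuclideanSpace ℝ (Fin m)) (hy : y = A x + ε)
    (xh : Fin p → EuclideanSpace ℝ (Fin n))
    (hfeas : ‖y - A xh‖ ≤ ζ)
    (hmin : ∀ z : Fin p → EuclideanSpace ℝ (Fin n), ‖y - A z‖ ≤ ζ → mnorm1 xh ≤ mnorm1 z)
    (β : ℝ) (hβ : 0 < β)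
    (hcmsv : ∀ z : Fin p → EuclideanSpace ℝ (Fin n),
      mnorm1 z ≤ 4 * (k : ℝ) ^ (1 - 1 / q) * mnorm q z → β * mnorm q z ≤ ‖A z‖) :
    mnorm q (xh - x) ≤ 2 * ζ / β + (k : ℝ) ^ (1 / q - 1) * φ := by
  have hfeas_x : ‖y - A x‖ ≤ ζ := by simpa [hy] using hε
  have hcone := mnorm1_sub_le_of_mnorm1_le (hmin x hfeas_x) S
  have hholder := sum_norm_le_card_rpow_mul_mnorm hq S (xh - x)
  rw [hScard] at hholder
  rw [← hφ] at hcone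
  have hφ0 : 0 ≤ φ := hφ ▸ Finset.sum_nonneg fun i _ => norm_nonneg _
  have hk0 : (0 : ℝ) < k := by exact_mod_cast hk
  have hc : 0 < (k : ℝ) ^ (1 - 1 / q) := Real.rpow_pos_of_pos hk0 _
  have hinv : (k : ℝ) ^ (1 / q - 1) = ((k : ℝ) ^ (1 - 1 / q))⁻¹ := by
    rw [← Real.rpow_neg hk0.le, neg_sub]
  rw [hinv]
  by_cases hsparse : mnorm1 (xh - x) ≤ 4 * (k : ℝ) ^ (1 - 1 / q) * mnorm q (xh - x)
  · have hA : ‖A (xh - x)‖ ≤ 2 * ζ := by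
      have heq : A (xh - x) = (y - A x) - (y - A xh) := by rw [map_sub]; abel
      rw [heq]
      linarith [norm_sub_le (y - A x) (y - A xh)]
    have hbound : mnorm q (xh - x) ≤ 2 * ζ / β := by
      rw [le_div_iff₀ hβ]
      linarith [hcmsv _ hsparse]
    have htail : 0 ≤ ((k : ℝ) ^ (1 - 1 / q))⁻¹ * φ := by positivity
    linarith
  · have hbound : mnorm q (xh - x) ≤ ((k : ℝ) ^ (1 - 1 / q))⁻¹ * φ := by
      rw [le_inv_mul_iff₀ hc]
      linarith
    have hnoise : 0 ≤ 2 * ζ / β := by positivity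
    linarith
end
end

section
/- Cone condition for ℓ₂/ℓ₁ minimizers with block compressible signals: let k ≥ 1, let x be any block signal, let S be a set of k block indices, set φ = ∑_{i∉S} ‖x_i‖₂, and let x̂ satisfy ‖x̂‖_{2,1} ≤ ‖x‖_{2,1}. Set h = x̂ − x. Then ‖h_{S^c}‖_{2,1} ≤ ‖h_S‖_{2,1} + 2φ, and consequently for every real q > 1, ‖h‖_{2,1} ≤ 2·k^{1-1/q}·‖h‖_{2,q} + 2φ. -/
open scoped BigOperators

noncomputable section

/-- Hölder's inequality for a nonnegative function against the indicator of a finite set. -/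
theorem sum_le_card_rpow_mul_rpow_sum {ι : Type*} (s : Finset ι) (f : ι → ℝ)
    (hf : ∀ i ∈ s, 0 ≤ f i) {q : ℝ} (hq : 1 < q) :
    ∑ i ∈ s, f i ≤ (s.card : ℝ) ^ (1 - 1 / q) * (∑ i ∈ s, f i ^ q) ^ (1 / q) := by
  have hpq := (Real.HolderConjugate.conjExponent hq).symm
  have h := Real.inner_le_Lp_mul_Lq_of_nonneg s hpq (f := fun _ ↦ 1) (g := f)
    (fun _ _ ↦ zero_le_one) hf
  have he : 1 / Real.conjExponent q = 1 - 1 / q := by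
    have := hpq.inv_add_inv_eq_one
    simp only [one_div]
    linarith
  simpa [he] using h

/-- The cone condition for a block signal whose mixed ℓ₂/ℓ₁ norm does not exceed that of `x`. -/
theorem sum_compl_norm_sub_le {ι E : Type*} [Fintype ι] [DecidableEq ι]
    [SeminormedAddCommGroup E] (S : Finset ι) {x y : ι → E}
    (h : ∑ i, ‖y i‖ ≤ ∑ i, ‖x i‖) :
    ∑ i ∈ Sᶜ, ‖y i - x i‖ ≤ ∑ i ∈ S, ‖y i - x i‖ + 2 * ∑ i ∈ Sᶜ, ‖x i‖ := by
  rw [← Finset.sum_add_sum_compl S, ← Finset.sum_add_sum_compl S (fun i ↦ ‖x i‖)] at h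
  have h₁ : ∑ i ∈ S, ‖x i‖ ≤ ∑ i ∈ S, ‖y i‖ + ∑ i ∈ S, ‖y i - x i‖ := by
    rw [← Finset.sum_add_distrib]
    exact Finset.sum_le_sum fun i _ ↦ norm_le_insert _ _
  have h₂ : ∑ i ∈ Sᶜ, ‖y i - x i‖ ≤ ∑ i ∈ Sᶜ, ‖y i‖ + ∑ i ∈ Sᶜ, ‖x i‖ := by
    rw [← Finset.sum_add_distrib]
    exact Finset.sum_le_sum fun i _ ↦ norm_sub_le _ _
  linarith

/-- Cone condition for ℓ₂/ℓ₁ minimizers with block compressible signals. -/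
theorem stmt_19 {p n : ℕ} (k : ℕ) (hk : 1 ≤ k)
    (S : Finset (Fin p)) (hS : S.card = k)
    (x : Fin p → EuclideanSpace ℝ (Fin n))
    (φ : ℝ) (hφ : φ = ∑ i ∈ Sᶜ, ‖x i‖)
    (xh : Fin p → EuclideanSpace ℝ (Fin n)) (hmin : mnorm1 xh ≤ mnorm1 x) :
    (∑ i ∈ Sᶜ, ‖(xh - x) i‖) ≤ (∑ i ∈ S, ‖(xh - x) i‖) + 2 * φ ∧
      ∀ q : ℝ, 1 < q →
        mnorm1 (xh - x) ≤ 2 * (k : ℝ) ^ (1 - 1 / q) * mnorm q (xh - x) + 2 * φ := by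
  subst hφ hS
  have hcone := sum_compl_norm_sub_le S hmin
  refine ⟨hcone, fun q hq ↦ ?_⟩
  have hS : ∑ i ∈ S, ‖(xh - x) i‖ ≤
      (S.card : ℝ) ^ (1 - 1 / q) * mnorm q (xh - x) := by
    refine (sum_le_card_rpow_mul_rpow_sum S _ (fun _ _ ↦ norm_nonneg _) hq).trans ?_
    unfold mnorm
    gcongr
    exact Finset.subset_univ S
  unfold mnorm1
  rw [← Finset.sum_add_sum_compl S]
  simp only [Pi.sub_apply] at hS ⊢
  linarith
end
end
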